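/- Fix k_0, u_0, k, k_r, u_r ∈ F^×, let O be a W-orbit in ℝ^r and y ∈ O, and write ḡ ∈ W_0 for the image of g ∈ W under the projection W = W_0 ⋉ ℤ^r → W_0. Then: (1) 𝔰_y = ḡ_y(𝔰_{c^O}), where ḡ_y is the image of g_y and W_0 acts on (F^×)^r by permuting and inverting coordinates; (2) for every t ∈ T_O, 𝔰_y·(g_yt) = g_y(𝔰_{c^O}·t) in T, where · denotes the coordinatewise product and g_y acts on T via the W-action; (3) 𝔰_{c^O} = 𝔰^O; and (4) 𝔰_{c^O}^{ᾱ_j^∨} = c_j^{−1} for every j ∈ {0,…,r} with α_j(c^O) = 0, where s^λ := s_1^{λ_1}⋯s_r^{λ_r} for s ∈ (F^×)^r and λ ∈ ℤ^r, ᾱ_0^∨ := −ε_1, ᾱ_i^∨ := ε_i − ε_{i+1} (1 ≤ i < r), ᾱ_r^∨ := ε_r, and c_0 := u_0u_r, c_i := k² for 1 ≤ i < r, c_r := k_0k_r. -/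

import Mathlib

open scoped Classical

noncomputable section

namespace QP

/-! ### The space of quasi-polynomials -/

/-- Euclidean space `ℝ^r`. -/
abbrev E (r : ℕ) := Fin r → ℝ

variable (F : Type*) [Field F] [CharZero F] (r : ℕ)

/-- The algebra of quasi-polynomials `F[ℝ^r]`: the group algebra of `(ℝ^r,+)` over `F`. -/
abbrev QA := AddMonoidAlgebra F (E r)

/-- The quasi-monomial `x^y`. -/
def X (y : E r) : QA F r := AddMonoidAlgebra.single y 1

/-- The `i`-th coordinate of a vector (`1`-based). -/
def cd (y : E r) (i : ℕ) : ℝ := ∑ m : Fin r, if (m : ℕ) + 1 = i then y m else 0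

/-- The standard basis vector `ε_i` (`1`-based). -/
def epsV (i : ℕ) : E r := fun m => if (m : ℕ) + 1 = i then 1 else 0

/-- The standard basis vector (`0`-based). -/
def eV (m : Fin r) : E r := fun n => if n = m then 1 else 0

/-- The Euclidean inner product on `ℝ^r`. -/
def ip (v y : E r) : ℝ := ∑ m : Fin r, v m * y m

/-- An integral vector regarded as an element of `ℝ^r`. -/
def zc (lam : Fin r → ℤ) : E r := fun m => (lam m : ℝ)

/-- The simple reflections of the hyperoctahedral group `W₀ = S_r ⋉ (±1)^r` (`1`-based):
for `1 ≤ i < r`, `sW i` interchanges the `i`-th and `(i+1)`-st coordinates, and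
`sW r` negates the last coordinate. -/
def sW (i : ℕ) (y : E r) : E r := fun m =>
  if i = r then (if (m : ℕ) + 1 = r then -y m else y m)
  else if (m : ℕ) + 1 = i then cd r y (i + 1)
  else if (m : ℕ) = i then cd r y i
  else y m

/-- `s_{ε₁} = s₁⋯s_{r-1} s_r s_{r-1}⋯s₁`: negation of the first coordinate. -/
def sEps1 (y : E r) : E r := fun m => if (m : ℕ) = 0 then -y m else y m

/-- The affine simple reflection `s₀ = τ(ε₁) s_{ε₁} : y ↦ (1 - y₁, y₂, …, y_r)`, together
with `genF j = sW j` for `1 ≤ j ≤ r`: the Coxeter generators of the affine Weyl group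
`W = W₀ ⋉ ℤ^r`. -/
def genF (j : ℕ) (y : E r) : E r :=
  if j = 0 then fun m => if (m : ℕ) = 0 then 1 - y m else y m
  else sW r j y

/-- The action of the word `s_{j₁} ⋯ s_{j_ℓ}` on `ℝ^r`. -/
def wordAct (l : List ℕ) (y : E r) : E r := l.foldr (genF r) y

/-- The closure of the fundamental alcove
`C₊ = {y : 0 < y_r < ⋯ < y₁ < 1/2}`. -/
def CplusCl : Set (E r) :=
  {y | (∀ i j : Fin r, i ≤ j → y j ≤ y i) ∧ ∀ m : Fin r, 0 ≤ y m ∧ y m ≤ 1 / 2}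

/-- The `W`-orbit of a point of `ℝ^r`. -/
def orbit (y : E r) : Set (E r) :=
  {z | ∃ l : List ℕ, (∀ a ∈ l, a ≤ r) ∧ wordAct r l y = z}

/-- `O` is a `W`-orbit in `ℝ^r`. -/
def IsOrbit (O : Set (E r)) : Prop := ∃ y, O = orbit r y

/-- `c^𝒪`: the unique point of the orbit `O` lying in the closed fundamental alcove. -/
def cpt (O : Set (E r)) : E r :=
  if h : ∃ c, c ∈ O ∧ c ∈ CplusCl r then h.choose else 0

/-- The length of an element of the affine Weyl group `W` (as a map on `ℝ^r`). -/
def wlen (g : E r → E r) : ℕ :=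
  sInf {n | ∃ l : List ℕ, (∀ a ∈ l, a ≤ r) ∧ l.length = n ∧ (fun y => wordAct r l y) = g}

/-- A choice of a shortest word `l` whose inverse maps `y` into the closed alcove;
the corresponding element of `W` is `g_y`. -/
def gW (y : E r) : List ℕ :=
  if h : ∃ l : List ℕ, (∀ a ∈ l, a ≤ r) ∧ wordAct r l.reverse y ∈ CplusCl r ∧
      ∀ l' : List ℕ, (∀ a ∈ l', a ≤ r) → wordAct r l'.reverse y ∈ CplusCl r →
        l.length ≤ l'.length
  then h.choose else []

/-- `g_y`, the unique shortest element of `W` with `g_y⁻¹ y` in the closed alcove. -/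
def gfun (y : E r) : E r → E r := fun z => wordAct r (gW r y) z

/-- The Bruhat order on `(W, {s₀,…,s_r})`, via the subword characterisation. -/
def bruhatLE (u v : E r → E r) : Prop :=
  ∃ l : List ℕ, (∀ a ∈ l, a ≤ r) ∧ (fun z => wordAct r l z) = v ∧ l.length = wlen r v ∧
    ∃ l' : List ℕ, l'.Sublist l ∧ (fun z => wordAct r l' z) = u ∧ l'.length = wlen r u

/-- The partial order on `ℝ^r`: `y' ≤ y` iff `y'` and `y` lie in the same `W`-orbit and
`g_{y'} ≤_B g_y` in the Bruhat order. -/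
def qle (y' y : E r) : Prop :=
  (∃ l : List ℕ, (∀ a ∈ l, a ≤ r) ∧ wordAct r l y = y') ∧ bruhatLE r (gfun r y') (gfun r y)

/-- Strict version of `qle`. -/
def qlt (y' y : E r) : Prop := qle r y' y ∧ y' ≠ y

/-- The `F`-linear operator on `F[ℝ^r]` determined by its values on the quasi-monomials. -/
def mkOp (Ψ : E r → QA F r) : Module.End F (QA F r) :=
  Finsupp.linearCombination F Ψ ∘ₗ (AddMonoidAlgebra.coeffLinearEquiv F).toLinearMap

/-- `F[O] = span_F {x^y : y ∈ O}`. -/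
def FO (O : Set (E r)) : Submodule F (QA F r) :=
  Submodule.span F {p | ∃ y ∈ O, p = X F r y}

/-- The Laurent polynomial subalgebra `F[ℤ^r] = span_F {x^μ : μ ∈ ℤ^r}`. -/
def Lspan : Submodule F (QA F r) :=
  Submodule.span F {p | ∃ lam : Fin r → ℤ, p = X F r (zc r lam)}

/-- `span_F {x^{y'} : y' < y}`. -/
def ltSpan (y : E r) : Submodule F (QA F r) :=
  Submodule.span F {p | ∃ y', qlt r y' y ∧ p = X F r y'}

/-! ### Floors and indicator/sign functions -/

/-- the largest even integer `≤ z` -/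
def floorE (z : ℝ) : ℤ := 2 * ⌊z / 2⌋
/-- the largest odd integer `≤ z` -/
def floorO (z : ℝ) : ℤ := 2 * ⌊(z + 1) / 2⌋ - 1
/-- indicator of `ℤ ⊆ ℝ` -/
def chiZ (z : ℝ) : ℕ := if ∃ n : ℤ, z = n then 1 else 0
/-- indicator of the even integers -/
def chiE (z : ℝ) : ℕ := if ∃ n : ℤ, z = 2 * n then 1 else 0
/-- indicator of the odd integers -/
def chiO (z : ℝ) : ℕ := if ∃ n : ℤ, z = 2 * n + 1 then 1 else 0
/-- `η_e`: `1` on even integers `≥ 2`, `-1` on even integers `≤ 0`, `0` otherwise -/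
def etaE (z : ℝ) : ℤ := if ∃ n : ℤ, z = 2 * n then (if 2 ≤ z then 1 else -1) else 0
/-- `η_o`: `1` on odd integers `≥ 1`, `-1` on odd integers `≤ -1`, `0` otherwise -/
def etaO (z : ℝ) : ℤ := if ∃ n : ℤ, z = 2 * n + 1 then (if 1 ≤ z then 1 else -1) else 0
/-- `η = η_e + η_o` -/
def eta (z : ℝ) : ℤ := etaE z + etaO z

/-- `geomS c v m` is the truncated geometric series `(1 - (c·x^v)^m)/(1 - c·x^v)`,
a genuine element of `F[ℝ^r]`; it is the unique element with
`(1 - c·x^v) * geomS c v m = 1 - c^m·x^{m v}`. -/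
def geomS (c : F) (v : E r) (m : ℤ) : QA F r :=
  if 0 ≤ m then ∑ t ∈ Finset.range m.toNat, c ^ (t : ℤ) • X F r ((t : ℝ) • v)
  else -∑ t ∈ Finset.range (-m).toNat, c ^ (-(t : ℤ) - 1) • X F r ((-(t : ℝ) - 1) • v)

/-! ### Truncated divided difference operators and Demazure–Lusztig operators -/

/-- `∇_i(x^y) = ((1 - (x_{i+1}/x_i)^{⌊y_i - y_{i+1}⌋})/(1 - x_i/x_{i+1}))·x^y`. -/
def nablaIel (i : ℕ) (y : E r) : QA F r :=
  geomS F r 1 (epsV r i - epsV r (i + 1)) (-⌊cd r y i - cd r y (i + 1)⌋) * X F r y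

/-- `∇_r^e(x^y) = ((1 - x_r^{-⌊2y_r⌋_e})/(1 - x_r^2))·x^y`. -/
def nablaReEl (y : E r) : QA F r :=
  geomS F r 1 ((2 : ℝ) • epsV r r) (-floorE (2 * cd r y r) / 2) * X F r y

/-- `∇_r^o(x^y) = ((x_r - x_r^{-⌊2y_r⌋_o})/(1 - x_r^2))·x^y`. -/
def nablaRoEl (y : E r) : QA F r :=
  X F r (epsV r r) *
    geomS F r 1 ((2 : ℝ) • epsV r r) ((-floorO (2 * cd r y r) - 1) / 2) * X F r y

def nablaIop (i : ℕ) : Module.End F (QA F r) := mkOp F r (nablaIel F r i)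
def nablaReOp : Module.End F (QA F r) := mkOp F r (nablaReEl F r)
def nablaRoOp : Module.End F (QA F r) := mkOp F r (nablaRoEl F r)

/-- The value of the truncated Demazure–Lusztig operator `T_i` (`1 ≤ i ≤ r`) on `x^y`. -/
def Tel (k kr ur : F) (i : ℕ) (y : E r) : QA F r :=
  if i = r then
    (kr ^ chiE (2 * cd r y r) * ur ^ chiO (2 * cd r y r)) • X F r (sW r r y)
      + (kr - kr⁻¹) • nablaReEl F r y + (ur - ur⁻¹) • nablaRoEl F r y
  else
    k ^ chiZ (cd r y i - cd r y (i + 1)) • X F r (sW r i y)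
      + (k - k⁻¹) • nablaIel F r i y

/-- The truncated Demazure–Lusztig operators `T_1, …, T_r` on `F[ℝ^r]`. -/
def Top (k kr ur : F) (i : ℕ) : Module.End F (QA F r) := mkOp F r (Tel F r k kr ur i)

/-! ### The torus and the affine generator -/

/-- `t^{ε_i}`: the `i`-th coordinate (`1`-based) of an element of the torus `T = (Fˣ)^r`. -/
def tcU (t : Fin r → Fˣ) (i : ℕ) : Fˣ := ∏ m : Fin r, if (m : ℕ) + 1 = i then t m else 1

/-- `t^λ` for `λ ∈ ℤ^r`. -/
def upow (t : Fin r → Fˣ) (lam : Fin r → ℤ) : Fˣ := ∏ m : Fin r, t m ^ lam m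

/-- `t^v` for a vector `v` with integral entries (entries read off via the floor). -/
def upowR (t : Fin r → Fˣ) (v : E r) : Fˣ := ∏ m : Fin r, t m ^ ⌊v m⌋

/-- The `W`-action on the torus `T = (Fˣ)^r`: for `g = τ(λ)w₀ ∈ W` (so `g y = w₀ y + λ`),
`(g t)_m = q^{λ_m} · t^{w₀⁻¹ ε_m}`, where `W₀` permutes and inverts coordinates and
`τ(λ) t = q^λ t`, with `q = (q^{1/2})²`. -/
def torusAct (qh : Fˣ) (g : E r → E r) (t : Fin r → Fˣ) : Fin r → Fˣ := fun m =>
  (qh * qh) ^ ⌊g 0 m⌋ * ∏ j : Fin r, t j ^ ⌊(g (eV r j) - g 0) m⌋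

/-- The action on the torus of the linear part of `g` alone (the `W₀`-action). -/
def torusAct0 (g : E r → E r) (t : Fin r → Fˣ) : Fin r → Fˣ := fun m =>
  ∏ j : Fin r, t j ^ ⌊(g (eV r j) - g 0) m⌋

/-- The simple affine roots `α₀(y) = 1 - 2y₁`, `α_i(y) = y_i - y_{i+1}` (`1 ≤ i < r`),
`α_r(y) = 2 y_r` as affine-linear functionals. -/
def alphaF (j : ℕ) (y : E r) : ℝ :=
  if j = 0 then 1 - 2 * cd r y 1
  else if j = r then 2 * cd r y r
  else cd r y j - cd r y (j + 1)

/-- `t^{α_j^∨}` where `α₀^∨ = (-ε₁, 1/2)`, `α_i^∨ = (ε_i - ε_{i+1}, 0)`, `α_r^∨ = (ε_r, 0)`. -/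
def tpowCo (qh : Fˣ) (t : Fin r → Fˣ) (j : ℕ) : Fˣ :=
  if j = 0 then qh * (tcU F r t 1)⁻¹
  else if j = r then tcU F r t r
  else tcU F r t j * (tcU F r t (j + 1))⁻¹

/-- The affine subtorus `T_𝒪 = {t ∈ T : t^{α_j^∨} = 1 whenever α_j(c^𝒪) = 0}`. -/
def TOset (qh : Fˣ) (O : Set (E r)) : Set (Fin r → Fˣ) :=
  {t | ∀ j : ℕ, j ≤ r → alphaF r j (cpt r O) = 0 → tpowCo F r qh t j = 1}

/-- `∇₀^e(x^y) = ((1 - (q^{-1/2}x₁)^{⌊-2y₁⌋_e})/(1 - q x₁^{-2}))·x^y`. -/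
def nabla0eEl (qh : F) (y : E r) : QA F r :=
  geomS F r (qh * qh) ((-2 : ℝ) • epsV r 1) (-floorE (-2 * cd r y 1) / 2) * X F r y

/-- `∇₀^o(x^y) = ((q^{1/2}x₁^{-1} - (q^{-1/2}x₁)^{⌊-2y₁⌋_o})/(1 - q x₁^{-2}))·x^y`. -/
def nabla0oEl (qh : F) (y : E r) : QA F r :=
  (qh • X F r ((-1 : ℝ) • epsV r 1)) *
    geomS F r (qh * qh) ((-2 : ℝ) • epsV r 1) ((-floorO (-2 * cd r y 1) - 1) / 2) * X F r y

/-- The value of `T₀^𝒪` on `x^y`. -/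
def T0el (qh : Fˣ) (k0 u0 : F) (t : Fin r → Fˣ) (y : E r) : QA F r :=
  (k0 ^ chiE (2 * cd r y 1) * u0 ^ chiO (2 * cd r y 1) *
      ((tcU F r (torusAct F r qh (gfun r y) t) 1 : Fˣ) : F)) • X F r (sEps1 r y)
    + (k0 - k0⁻¹) • nabla0eEl F r qh y + (u0 - u0⁻¹) • nabla0oEl F r qh y

/-- The operator `T₀^𝒪` (as a globally defined operator; on `F[𝒪]` it is the operator of
the quasi-polynomial representation). -/
def T0op (qh : Fˣ) (k0 u0 : F) (t : Fin r → Fˣ) : Module.End F (QA F r) :=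
  mkOp F r (T0el F r qh k0 u0 t)

/-- The full family `T₀^𝒪, T₁, …, T_r`. -/
def Tfull (qh : Fˣ) (k0 u0 k kr ur : F) (t : Fin r → Fˣ) (j : ℕ) : Module.End F (QA F r) :=
  if j = 0 then T0op F r qh k0 u0 t else Top F r k kr ur j

/-- The Hecke parameter `k_j` (`k₀`, `k` or `k_r`). -/
def kpar (k0 k kr : F) (j : ℕ) : F := if j = 0 then k0 else if j = r then kr else k

/-- `(T_j^𝒪)⁻¹ = T_j^𝒪 - k_j + k_j⁻¹` (the inverse on `F[𝒪]`, by the Hecke relation). -/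
def TfullInv (qh : Fˣ) (k0 u0 k kr ur : F) (t : Fin r → Fˣ) (j : ℕ) : Module.End F (QA F r) :=
  Tfull F r qh k0 u0 k kr ur t j - (kpar F r k0 k kr j - (kpar F r k0 k kr j)⁻¹) • 1

/-- The word `0, 1, …, r-1, r, r-1, …, i` used in the definition of `Y_i^𝒪`. -/
def Ylist (i : ℕ) : List ℕ :=
  0 :: (((List.range (r - 1)).map (· + 1)) ++ [r] ++ ((List.range (r - i)).map fun m => r - 1 - m))

/-- The commuting operators
`Y_i^𝒪 = (T_{i-1}^𝒪)⁻¹⋯(T₁^𝒪)⁻¹ · T₀^𝒪 · T₁^𝒪⋯T_{r-1}^𝒪 · T_r^𝒪 · T_{r-1}^𝒪⋯T_i^𝒪`. -/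
def Yop (qh : Fˣ) (k0 u0 k kr ur : F) (t : Fin r → Fˣ) (i : ℕ) : Module.End F (QA F r) :=
  ((((List.range (i - 1)).map (· + 1)).reverse.map (TfullInv F r qh k0 u0 k kr ur t)).prod) *
    (((Ylist r i).map (Tfull F r qh k0 u0 k kr ur t)).prod)

/-! ### The base points `𝔰^𝒪`, `𝔰_y` and the spectrum -/

/-- `n_i^𝒪` (with `c = c^𝒪`), resp. `m_i(y)` (with `c = y`). -/
def nO (c : E r) (m : Fin r) : ℤ :=
  (∑ j : Fin r, if m < j then eta (c m - c j) + eta (c m + c j) else 0) +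
    ∑ j : Fin r, if j < m then eta (c j + c m) - eta (c j - c m) else 0

/-- The base point `𝔰^𝒪 ∈ T`. -/
def sOtor (k0 u0 k kr ur : Fˣ) (O : Set (E r)) : Fin r → Fˣ := fun m =>
  (k0 * kr) ^ (-(chiE (2 * cpt r O m) : ℤ)) * (u0 * ur) ^ (chiO (2 * cpt r O m) : ℤ) *
    k ^ nO r (cpt r O) m

/-- The eigenvalue `γ_i^𝒪(y) = ((g_y(𝔰^𝒪·t))_i)⁻¹`. -/
def gammaO (qh k0 u0 k kr ur : Fˣ) (O : Set (E r)) (t : Fin r → Fˣ) (i : ℕ) (y : E r) : Fˣ :=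
  (tcU F r (torusAct F r qh (gfun r y) fun m => sOtor F r k0 u0 k kr ur O m * t m) i)⁻¹

/-- `𝔰_y ∈ T`. -/
def sfrak (k0 u0 k kr ur : Fˣ) (y : E r) : Fin r → Fˣ := fun m =>
  (k0 * kr) ^ etaE (2 * y m) * (u0 * ur) ^ etaO (2 * y m) * k ^ nO r y m

/-! ### Finite Weyl group combinatorics, positive roots -/

/-- The set of positive roots of type `C_r`. -/
def PhiPlus : Set (E r) :=
  {v | (∃ a b : Fin r, a < b ∧ v = eV r a - eV r b) ∨
       (∃ a b : Fin r, a < b ∧ v = eV r a + eV r b) ∨ ∃ a : Fin r, v = (2 : ℝ) • eV r a}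

/-- The root system of type `C_r`. -/
def Phi0 : Set (E r) := PhiPlus r ∪ {v | -v ∈ PhiPlus r}

/-- The normalisation factor `κ_w^𝒪 = ∏_{α ∈ Π(w)} 𝐤_α^{χ_e(α(c))}·𝐤_{α/2}^{-χ_o(α(c))}`,
where `Π(w) = {α ∈ Φ₀⁺ : wα ∈ -Φ₀⁺}`, `𝐤_α = 𝐤_{α/2} = k` for short roots and
`𝐤_α = k_r`, `𝐤_{α/2} = u_r` for long roots. -/
def kappaW (k kr ur : Fˣ) (w : E r → E r) (c : E r) : Fˣ :=
  (∏ p : Fin r × Fin r,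
      if p.1 < p.2 ∧ -w (eV r p.1 - eV r p.2) ∈ PhiPlus r then
        k ^ ((chiE (ip r (eV r p.1 - eV r p.2) c) : ℤ) - (chiO (ip r (eV r p.1 - eV r p.2) c) : ℤ))
      else 1) *
  (∏ p : Fin r × Fin r,
      if p.1 < p.2 ∧ -w (eV r p.1 + eV r p.2) ∈ PhiPlus r then
        k ^ ((chiE (ip r (eV r p.1 + eV r p.2) c) : ℤ) - (chiO (ip r (eV r p.1 + eV r p.2) c) : ℤ))
      else 1) *
  ∏ a : Fin r,
      if -w ((2 : ℝ) • eV r a) ∈ PhiPlus r then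
        kr ^ (chiE (ip r ((2 : ℝ) • eV r a) c) : ℤ) * ur ^ (-(chiO (ip r ((2 : ℝ) • eV r a) c) : ℤ))
      else 1

/-- Iterated application `T_{i₁}(T_{i₂}(⋯(T_{i_ℓ}(f))⋯))`. -/
def applyT (k kr ur : F) (l : List ℕ) (f : QA F r) : QA F r :=
  l.foldr (fun i g => Top F r k kr ur i g) f

/-- The length function of the finite Weyl group `W₀`. -/
def w0len (g : E r → E r) : ℕ :=
  sInf {n | ∃ l : List ℕ, (∀ a ∈ l, 1 ≤ a ∧ a ≤ r) ∧ l.length = n ∧ (fun y => wordAct r l y) = g}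

/-- Membership in `W₀` (as maps on `ℝ^r`). -/
def IsW0fun (w : E r → E r) : Prop :=
  ∃ l : List ℕ, (∀ a ∈ l, 1 ≤ a ∧ a ≤ r) ∧ w = fun y => wordAct r l y

/-- Membership in the parabolic subgroup `W_{0,𝒪}` generated by the `s_i`, `1 ≤ i ≤ r`,
with `α_i(c^𝒪) = 0`. -/
def IsWOOfun (O : Set (E r)) (u : E r → E r) : Prop :=
  ∃ l : List ℕ, (∀ a ∈ l, 1 ≤ a ∧ a ≤ r ∧ alphaF r a (cpt r O) = 0) ∧
    u = fun y => wordAct r l y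

/-- `v ∈ W₀^𝒪`: `v ∈ W₀` of minimal length in its coset `v·W_{0,𝒪}`. -/
def MinRep (O : Set (E r)) (v : E r → E r) : Prop :=
  IsW0fun r v ∧ ∀ u, IsWOOfun r O u → w0len r v ≤ w0len r fun y => v (u y)

/-- Membership in the affine Weyl group `W` (as maps on `ℝ^r`). -/
def IsWfun (g : E r → E r) : Prop :=
  ∃ l : List ℕ, (∀ a ∈ l, a ≤ r) ∧ g = fun y => wordAct r l y

/-- Membership in the parabolic subgroup `W_{J(𝒪)}` generated by the `s_j`, `j ∈ J(𝒪)`. -/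
def IsWJfun (O : Set (E r)) (u : E r → E r) : Prop :=
  ∃ l : List ℕ, (∀ a ∈ l, a ≤ r ∧ alphaF r a (cpt r O) = 0) ∧ u = fun y => wordAct r l y

/-- The `W`-action on the Laurent polynomials `F[ℤ^r]` by `q`-dilations and reflections:
`w(x^μ) = x^{wμ}` for `w ∈ W₀`, `τ(λ)(x^μ) = q^{-⟨μ,λ⟩} x^μ` (globally defined via the
linear/translation parts of `g`). -/
def LWact (qh : Fˣ) (g : E r → E r) : Module.End F (QA F r) :=
  mkOp F r fun v => (((qh * qh) ^ (-⌊ip r (g v - g 0) (g 0)⌋) : Fˣ) : F) • X F r (g v - g 0)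

/-! ### roots `ᾱ_j`, torus reflections -/

/-- The finite simple roots `ᾱ₀ = -2ε₁`, `ᾱ_i = ε_i - ε_{i+1}`, `ᾱ_r = 2ε_r`
(as integral vectors). -/
def abarI (j : ℕ) : Fin r → ℤ := fun m =>
  if j = 0 then (if (m : ℕ) = 0 then -2 else 0)
  else if j = r then (if (m : ℕ) + 1 = r then 2 else 0)
  else if (m : ℕ) + 1 = j then 1
  else if (m : ℕ) = j then -1
  else 0

/-- The corresponding coroots `ᾱ₀^∨ = -ε₁`, `ᾱ_i^∨ = ε_i - ε_{i+1}`, `ᾱ_r^∨ = ε_r`. -/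
def abarV (j : ℕ) : Fin r → ℤ := fun m =>
  if j = 0 then (if (m : ℕ) = 0 then -1 else 0)
  else if j = r then (if (m : ℕ) + 1 = r then 1 else 0)
  else if (m : ℕ) + 1 = j then 1
  else if (m : ℕ) = j then -1
  else 0

/-- `ᾱ_j` as a real vector. -/
def abarR (j : ℕ) : E r := fun m => ((abarI r j m : ℤ) : ℝ)

/-- The constants `c₀ = u₀u_r`, `c_i = k²`, `c_r = k₀k_r`. -/
def cpar (k0 u0 k kr ur : Fˣ) (j : ℕ) : Fˣ :=
  if j = 0 then u0 * ur else if j = r then k0 * kr else k * k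

/-- The action of the reflection `s_{ᾱ_j} ∈ W₀` on the torus `T` (with `s_{ᾱ₀} = s_{ε₁}`). -/
def sTor (j : ℕ) (t : Fin r → Fˣ) : Fin r → Fˣ := fun m =>
  if j = 0 then (if (m : ℕ) = 0 then (t m)⁻¹ else t m)
  else if j = r then (if (m : ℕ) + 1 = r then (t m)⁻¹ else t m)
  else if (m : ℕ) + 1 = j then tcU F r t (j + 1)
  else if (m : ℕ) = j then tcU F r t j
  else t m

/-! ### The operators `G_t^𝒪(a)` for affine roots `a = (α, n)` -/

/-- The coroot `α^∨ = 2α/⟨α,α⟩`. -/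
def coroot (v : E r) : E r := ((2 : ℝ) / ip r v v) • v

/-- The scalar `q^{2n/⟨α,α⟩}` appearing in `x^{a^∨}` for `a = (α,n)`. -/
def qsc (qh : Fˣ) (v : E r) (n : ℤ) : Fˣ := if ip r v v = 4 then qh ^ n else (qh * qh) ^ n

/-- `𝐤_a`: `k` if `α` is short; `k_r` if `α` long, `n` even; `k₀` if `α` long, `n` odd. -/
def kaf (k0 k kr : Fˣ) (v : E r) (n : ℤ) : Fˣ :=
  if ip r v v = 4 then (if Even n then kr else k0) else k

/-- `𝐤_{a/2}`: `k` if `α` is short; `u_r` if `α` long, `n` even; `u₀` if `α` long, `n` odd. -/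
def khaf (u0 k ur : Fˣ) (v : E r) (n : ℤ) : Fˣ :=
  if ip r v v = 4 then (if Even n then ur else u0) else k

/-- The reflection `s_α(y) = y - α(y)·α^∨`. -/
def sRefl (v y : E r) : E r := y - ip r v y • coroot r v

/-- `s_{a,t}(x^y) = (g_y t)^{-n α^∨} · x^{s_α y}`. -/
def saTel (qh : Fˣ) (t : Fin r → Fˣ) (v : E r) (n : ℤ) (y : E r) : QA F r :=
  ((upowR F r (torusAct F r qh (gfun r y) t) (((-n : ℤ) : ℝ) • coroot r v) : Fˣ) : F) •
    X F r (sRefl r v y)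

/-- The twisted reflection operator `s_{a,t}`. -/
def SaOp (qh : Fˣ) (t : Fin r → Fˣ) (v : E r) (n : ℤ) : Module.End F (QA F r) :=
  mkOp F r (saTel F r qh t v n)

/-- The value `G_t^𝒪(a)(x^y)` for the affine root `a = (v, n)`. -/
def Gel (qh k0 u0 k kr ur : Fˣ) (t : Fin r → Fˣ) (v : E r) (n : ℤ) (y : E r) : QA F r :=
  (((kaf F r k0 k kr v n : Fˣ) : F) ^ chiE (ip r v y) *
      ((khaf F r u0 k ur v n : Fˣ) : F) ^ chiO (ip r v y)) • X F r y
    + ((((kaf F r k0 k kr v n : Fˣ) : F) - ((kaf F r k0 k kr v n : Fˣ) : F)⁻¹) •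
          geomS F r (((qsc F r qh v n)⁻¹ * (qsc F r qh v n)⁻¹ : Fˣ) : F)
            ((-2 : ℝ) • coroot r v) (-floorE (ip r v y) / 2)
        + (((khaf F r u0 k ur v n : Fˣ) : F) - ((khaf F r u0 k ur v n : Fˣ) : F)⁻¹) •
          ((((qsc F r qh v n)⁻¹ : Fˣ) : F) • X F r ((-1 : ℝ) • coroot r v) *
            geomS F r (((qsc F r qh v n)⁻¹ * (qsc F r qh v n)⁻¹ : Fˣ) : F)
              ((-2 : ℝ) • coroot r v) (-(floorO (ip r v y) + 1) / 2))) *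
      saTel F r qh t v n y

/-- The operator `G_t^𝒪(a)` for `a = (v, n)`. -/
def Gop (qh k0 u0 k kr ur : Fˣ) (t : Fin r → Fˣ) (v : E r) (n : ℤ) : Module.End F (QA F r) :=
  mkOp F r (Gel F r qh k0 u0 k kr ur t v n)

/-- The twisted action `g_t` of `g ∈ W` on `F[𝒪]`:
`g_t(x^y) = (g_{w₀ y} t)^{-λ} x^{w₀ y}` for `g = τ(λ) w₀`. -/
def Wtw (qh : Fˣ) (t : Fin r → Fˣ) (g : E r → E r) : Module.End F (QA F r) :=
  mkOp F r fun y =>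
    (((upowR F r (torusAct F r qh (gfun r (g y - g 0)) t) (g 0))⁻¹ : Fˣ) : F) •
      X F r (g y - g 0)

/-! ### The operators `D_j` -/

/-- The palindromic word `1, …, r-1, r, r-1, …, 1`. -/
def palin : List ℕ :=
  ((List.range (r - 1)).map (· + 1)) ++ [r] ++ ((List.range (r - 1)).map (· + 1)).reverse

/-- Multiplication by `x^{-ε₁}`. -/
def Mop : Module.End F (QA F r) := mkOp F r fun y => X F r ((-1 : ℝ) • epsV r 1) * X F r y

/-- `D₀ = (T₁^𝒪 ⋯ T_{r-1}^𝒪 T_r^𝒪 T_{r-1}^𝒪 ⋯ T₁^𝒪)⁻¹ ∘ M`. -/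
def D0op (qh : Fˣ) (k0 u0 k kr ur : F) (t : Fin r → Fˣ) : Module.End F (QA F r) :=
  ((palin r).map (TfullInv F r qh k0 u0 k kr ur t)).prod * Mop F r

/-- `D_j`: `D₀` for `j = 0` and `T_j^𝒪` for `1 ≤ j ≤ r`. -/
def Dop (qh : Fˣ) (k0 u0 k kr ur : F) (t : Fin r → Fˣ) (j : ℕ) : Module.End F (QA F r) :=
  if j = 0 then D0op F r qh k0 u0 k kr ur t else Tfull F r qh k0 u0 k kr ur t j

/-- Iterated application `D_{j₁}(D_{j₂}(⋯(D_{j_ℓ}(f))⋯))`. -/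
def applyD (qh : Fˣ) (k0 u0 k kr ur : F) (t : Fin r → Fˣ) (l : List ℕ) (f : QA F r) : QA F r :=
  l.foldr (fun j g => Dop F r qh k0 u0 k kr ur t j g) f

/-- The coefficients `k_{s_j}(y)`. -/
def ksj (k kr ur : Fˣ) (j : ℕ) (y : E r) : Fˣ :=
  if j = 0 then
    kr ^ (-etaE (2 * cd r y 1)) * ur ^ (-etaO (2 * cd r y 1)) *
      ∏ m : Fin r,
        (if 1 ≤ (m : ℕ) then k ^ (-eta (cd r y 1 - y m) - eta (cd r y 1 + y m)) else 1)
  else if j = r then kr ^ (-etaE (2 * cd r y r)) * ur ^ (-etaO (2 * cd r y r))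
  else k ^ (-eta (cd r y j - cd r y (j + 1)))

/-- `k_w(c) = ∏_m k_{s_{j_m}}(s_{j_{m+1}} ⋯ s_{j_ℓ} c)` for the word `w = s_{j₁} ⋯ s_{j_ℓ}`. -/
def kword (k kr ur : Fˣ) (l : List ℕ) (z : E r) : Fˣ :=
  (l.foldr (fun j p => (genF r j p.1, ksj F r k kr ur j p.1 * p.2)) (z, (1 : Fˣ))).2


/-! ### Helper lemmas -/

theorem etaE_even (n : ℤ) : etaE (2 * (n : ℝ)) = if 1 ≤ n then 1 else -1 := by
  unfold etaE
  rw [if_pos ⟨n, rfl⟩]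
  have : (2 : ℝ) ≤ 2 * n ↔ 1 ≤ n := by
    constructor
    · intro h
      have : (1 : ℝ) ≤ n := by linarith
      exact_mod_cast this
    · intro h
      have : (1 : ℝ) ≤ n := by exact_mod_cast h
      linarith
  simp only [this]

theorem etaE_not (z : ℝ) (h : ¬ ∃ n : ℤ, z = 2 * n) : etaE z = 0 := if_neg h

theorem etaO_odd (n : ℤ) : etaO (2 * (n : ℝ) + 1) = if 0 ≤ n then 1 else -1 := by
  unfold etaO
  rw [if_pos ⟨n, rfl⟩]
  have : (1 : ℝ) ≤ 2 * n + 1 ↔ 0 ≤ n := by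
    constructor
    · intro h
      have : (0 : ℝ) ≤ n := by linarith
      exact_mod_cast this
    · intro h
      have : (0 : ℝ) ≤ n := by exact_mod_cast h
      linarith
  simp only [this]

theorem etaO_not (z : ℝ) (h : ¬ ∃ n : ℤ, z = 2 * n + 1) : etaO z = 0 := if_neg h

theorem eta_int (n : ℤ) : eta (n : ℝ) = if 1 ≤ n then 1 else -1 := by
  unfold eta
  rcases Int.even_or_odd' n with ⟨a, rfl | rfl⟩
  · rw [etaO_not]
    · push_cast
      rw [etaE_even]
      split_ifs <;> omega
    · rintro ⟨b, hb⟩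
      have : 2 * a = 2 * b + 1 := by exact_mod_cast hb
      omega
  · rw [etaE_not]
    · push_cast
      rw [etaO_odd]
      split_ifs <;> omega
    · rintro ⟨b, hb⟩
      have : 2 * a + 1 = 2 * b := by exact_mod_cast hb
      omega

theorem eta_not (z : ℝ) (h : ¬ ∃ n : ℤ, z = n) : eta z = 0 := by
  unfold eta
  rw [etaE_not, etaO_not]
  · rfl
  · rintro ⟨n, rfl⟩
    exact h ⟨2 * n + 1, by push_cast; rfl⟩
  · rintro ⟨n, rfl⟩
    exact h ⟨2 * n, by push_cast; rfl⟩

theorem eta_neg (z : ℝ) (hz : z ≠ 0) : eta (-z) = -eta z := by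
  by_cases h : ∃ n : ℤ, z = n
  · obtain ⟨n, rfl⟩ := h
    have hn : n ≠ 0 := by exact_mod_cast hz
    rw [← Int.cast_neg, eta_int, eta_int]
    split_ifs <;> omega
  · rw [eta_not z h, eta_not, neg_zero]
    rintro ⟨n, hn⟩
    exact h ⟨-n, by push_cast; linarith⟩

theorem eta_one_sub (z : ℝ) : eta (1 - z) = -eta z := by
  by_cases h : ∃ n : ℤ, z = n
  · obtain ⟨n, rfl⟩ := h
    have e : (1 : ℝ) - n = ((1 - n : ℤ) : ℝ) := by push_cast; rfl
    rw [e, eta_int, eta_int]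
    split_ifs <;> omega
  · rw [eta_not z h, eta_not, neg_zero]
    rintro ⟨n, hn⟩
    exact h ⟨1 - n, by push_cast; linarith⟩

theorem eta_zero : eta 0 = -1 := by
  have := eta_int 0
  simpa using this

theorem etaE_neg (z : ℝ) (hz : z ≠ 0) : etaE (-z) = -etaE z := by
  by_cases h : ∃ n : ℤ, z = 2 * n
  · obtain ⟨n, rfl⟩ := h
    have hn : n ≠ 0 := by
      rintro rfl
      simp at hz
    have e : -(2 * (n : ℝ)) = 2 * ((-n : ℤ) : ℝ) := by push_cast; ring
    rw [e, etaE_even, etaE_even]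
    split_ifs <;> omega
  · rw [etaE_not z h, etaE_not, neg_zero]
    rintro ⟨n, hn⟩
    exact h ⟨-n, by push_cast; linarith⟩

theorem etaO_neg (z : ℝ) : etaO (-z) = -etaO z := by
  by_cases h : ∃ n : ℤ, z = 2 * n + 1
  · obtain ⟨n, rfl⟩ := h
    have e : -(2 * (n : ℝ) + 1) = 2 * ((-n - 1 : ℤ) : ℝ) + 1 := by push_cast; ring
    rw [e, etaO_odd, etaO_odd]
    split_ifs <;> omega
  · rw [etaO_not z h, etaO_not, neg_zero]
    rintro ⟨n, hn⟩
    exact h ⟨-n - 1, by push_cast; linarith⟩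

theorem etaE_two_sub (z : ℝ) : etaE (2 - z) = -etaE z := by
  by_cases h : ∃ n : ℤ, z = 2 * n
  · obtain ⟨n, rfl⟩ := h
    have e : 2 - (2 * (n : ℝ)) = 2 * ((1 - n : ℤ) : ℝ) := by push_cast; ring
    rw [e, etaE_even, etaE_even]
    split_ifs <;> omega
  · rw [etaE_not z h, etaE_not, neg_zero]
    rintro ⟨n, hn⟩
    exact h ⟨1 - n, by push_cast; linarith⟩

theorem etaO_two_sub (z : ℝ) (hz : z ≠ 1) : etaO (2 - z) = -etaO z := by
  by_cases h : ∃ n : ℤ, z = 2 * n + 1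
  · obtain ⟨n, rfl⟩ := h
    have hn : n ≠ 0 := by
      rintro rfl
      simp at hz
    have e : 2 - (2 * (n : ℝ) + 1) = 2 * ((-n : ℤ) : ℝ) + 1 := by push_cast; ring
    rw [e, etaO_odd, etaO_odd]
    split_ifs <;> omega
  · rw [etaO_not z h, etaO_not, neg_zero]
    rintro ⟨n, hn⟩
    exact h ⟨-n, by push_cast; linarith⟩

/-! generators -/

theorem cd_eq (y : E r) (m : Fin r) (i : ℕ) (h : (m : ℕ) + 1 = i) : cd r y i = y m := by
  unfold cd
  rw [Finset.sum_eq_single m]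
  · simp [h]
  · intro b _ hb
    rw [if_neg]
    intro h'
    exact hb (Fin.ext (by omega))
  · simp

theorem genF_zero (y : E r) (z : Fin r) (hz : (z : ℕ) = 0) :
    genF r 0 y = Function.update y z (1 - y z) := by
  funext m
  unfold genF
  by_cases h : m = z
  · subst h
    simp [hz]
  · have : (m : ℕ) ≠ 0 := fun h' => h (Fin.ext (by omega))
    simp [h, this]

theorem genF_last (y : E r) (z : Fin r) (hz : (z : ℕ) + 1 = r) :
    genF r r y = Function.update y z (-y z) := by
  funext m
  have hr : r ≠ 0 := by omega
  unfold genF sW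
  by_cases h : m = z
  · subst h
    simp [hz, hr]
  · have : (m : ℕ) + 1 ≠ r := fun h' => h (Fin.ext (by omega))
    simp [h, this, hr]

theorem genF_mid (y : E r) (p p' : Fin r) (h : (p' : ℕ) = (p : ℕ) + 1) :
    genF r p' y = y ∘ Equiv.swap p p' := by
  funext m
  have h0 : (p' : ℕ) ≠ 0 := by omega
  have h1 : (p' : ℕ) ≠ r := by omega
  unfold genF sW
  rw [if_neg h0, if_neg h1, cd_eq r y p' _ rfl, cd_eq r y p _ h.symm]
  by_cases hm : m = p
  · subst hm
    simp [h]
  · have e1 : (m : ℕ) + 1 ≠ p' := fun h' => hm (Fin.ext (by omega))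
    rw [if_neg e1]
    by_cases hm' : m = p'
    · subst hm'
      simp
    · have e2 : (m : ℕ) ≠ p' := fun h' => hm' (Fin.ext (by omega))
      rw [if_neg e2]
      simp [Equiv.swap_apply_of_ne_of_ne hm hm']

/-- Case analysis on generators. -/
theorem gen_cases (hr : 2 ≤ r) (a : ℕ) (ha : a ≤ r) :
    (∃ z : Fin r, (z : ℕ) = 0 ∧ a = 0) ∨ (∃ z : Fin r, (z : ℕ) + 1 = r ∧ a = r) ∨
      ∃ p p' : Fin r, (p' : ℕ) = (p : ℕ) + 1 ∧ a = p' := by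
  by_cases h0 : a = 0
  · exact Or.inl ⟨⟨0, by omega⟩, rfl, h0⟩
  · by_cases h1 : a = r
    · exact Or.inr (Or.inl ⟨⟨r - 1, by omega⟩, by simp; omega, h1⟩)
    · exact Or.inr (Or.inr ⟨⟨a - 1, by omega⟩, ⟨a, by omega⟩, by simp; omega, rfl⟩)

theorem genF_invol (hr : 2 ≤ r) (a : ℕ) (ha : a ≤ r) (y : E r) :
    genF r a (genF r a y) = y := by
  rcases gen_cases r hr a ha with ⟨z, hz, rfl⟩ | ⟨z, hz, rfl⟩ | ⟨p, p', hp, rfl⟩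
  · simp [genF_zero r _ z hz]
  · simp [genF_last _ _ z hz]
  · rw [genF_mid r _ p p' hp, genF_mid r _ p p' hp]
    funext m
    simp

/-- Signed affine permutations. -/
def IsRep (g : E r → E r) (σ : Equiv.Perm (Fin r)) (s lam : Fin r → ℤ) : Prop :=
  (∀ m, s m = 1 ∨ s m = -1) ∧ ∀ y m, g y m = s m * y (σ m) + lam m

theorem isRep_gen (hr : 2 ≤ r) (a : ℕ) (ha : a ≤ r) :
    ∃ σ s lam, IsRep r (genF r a) σ s lam := by
  rcases gen_cases r hr a ha with ⟨z, hz, rfl⟩ | ⟨z, hz, rfl⟩ | ⟨p, p', hp, rfl⟩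
  · refine ⟨1, fun m => if m = z then -1 else 1, fun m => if m = z then 1 else 0, ?_, ?_⟩
    · intro m
      by_cases h : m = z <;> simp [h]
    · intro y m
      rw [genF_zero r _ z hz]
      by_cases h : m = z
      · subst h
        simp
        ring
      · simp [h]
  · refine ⟨1, fun m => if m = z then -1 else 1, fun m => 0, ?_, ?_⟩
    · intro m
      by_cases h : m = z <;> simp [h]
    · intro y m
      rw [genF_last _ _ z hz]
      by_cases h : m = z
      · subst h
        simp
      · simp [h]
  · refine ⟨Equiv.swap p p', fun m => 1, fun m => 0, ?_, ?_⟩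
    · intro m
      simp
    · intro y m
      rw [genF_mid r _ p p' hp]
      simp

theorem isRep_word (hr : 2 ≤ r) (l : List ℕ) (hl : ∀ a ∈ l, a ≤ r) :
    ∃ σ s lam, IsRep r (wordAct r l) σ s lam := by
  induction l with
  | nil => exact ⟨1, fun _ => 1, fun _ => 0, by simp, by simp [wordAct]⟩
  | cons a l ih =>
    obtain ⟨σ, s, lam, h1, h2⟩ := ih fun b hb => hl b (List.mem_cons_of_mem _ hb)
    obtain ⟨σ', s', lam', h1', h2'⟩ := isRep_gen r hr a (hl a List.mem_cons_self)
    refine ⟨σ'.trans σ, fun m => s' m * s (σ' m), fun m => s' m * lam (σ' m) + lam' m, ?_, ?_⟩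
    · intro m
      rcases h1' m with h | h <;> rcases h1 (σ' m) with h' | h' <;> simp [h, h']
    · intro y m
      change genF r a (wordAct r l y) m = _
      rw [h2', h2]
      push_cast
      simp
      ring

theorem torusAct0_rep (g : E r → E r) (σ : Equiv.Perm (Fin r)) (s lam : Fin r → ℤ)
    (h : IsRep r g σ s lam) (t : Fin r → Fˣ) (m : Fin r) :
    torusAct0 F r g t m = t (σ m) ^ s m := by
  unfold torusAct0
  have e : ∀ j, ⌊(g (eV r j) - g 0) m⌋ = if σ m = j then s m else 0 := by
    intro j
    rw [Pi.sub_apply, h.2, h.2]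
    by_cases hj : σ m = j
    · simp [eV, hj]
    · simp [eV, hj]
  simp only [e]
  rw [Finset.prod_eq_single (σ m)]
  · simp
  · intro b _ hb
    simp [hb.symm]
  · simp

theorem torusAct0_cons (hr : 2 ≤ r) (a : ℕ) (l : List ℕ) (ha : a ≤ r) (hl : ∀ a ∈ l, a ≤ r)
    (t : Fin r → Fˣ) :
    torusAct0 F r (wordAct r (a :: l)) t
      = torusAct0 F r (genF r a) (torusAct0 F r (wordAct r l) t) := by
  obtain ⟨σ, s, lam, h1, h2⟩ := isRep_word r hr l hl
  obtain ⟨σ', s', lam', h1', h2'⟩ := isRep_gen r hr a ha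
  funext m
  rw [torusAct0_rep F r (genF r a) σ' s' lam' ⟨h1', h2'⟩,
    torusAct0_rep F r (wordAct r l) σ s lam ⟨h1, h2⟩,
    torusAct0_rep F r (wordAct r (a :: l)) (σ'.trans σ) (fun m => s' m * s (σ' m))
      (fun m => s' m * lam (σ' m) + lam' m)]
  · rw [← zpow_mul, mul_comm]
    rfl
  · refine ⟨?_, ?_⟩
    · intro m
      rcases h1' m with h | h <;> rcases h1 (σ' m) with h' | h' <;> simp [h, h']
    · intro y m
      change genF r a (wordAct r l y) m = _
      rw [h2', h2]
      push_cast
      simp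
      ring

/-! the exponents -/

/-- summand of `nO`. -/
def fD (y : E r) (m j : Fin r) : ℤ :=
  if m < j then eta (y m - y j) + eta (y m + y j)
  else if j < m then eta (y j + y m) - eta (y j - y m) else 0

theorem nO_eq (y : E r) (m : Fin r) : nO r y m = ∑ j, fD r y m j := by
  unfold nO
  rw [← Finset.sum_add_distrib]
  refine Finset.sum_congr rfl fun j _ => ?_
  unfold fD
  rcases lt_trichotomy m j with h | h | h
  · simp [h, h.not_gt]
  · simp [h]
  · simp [h, h.not_gt]

theorem nO_zero_self (y : E r) (z : Fin r) (hz : (z : ℕ) = 0) :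
    nO r (Function.update y z (1 - y z)) z = -nO r y z := by
  rw [nO_eq, nO_eq, ← Finset.sum_neg_distrib]
  refine Finset.sum_congr rfl fun j _ => ?_
  unfold fD
  by_cases h : j = z
  · simp [h]
  · have : z < j := by
      rw [Fin.lt_def]
      have : (j : ℕ) ≠ z := fun h' => h (Fin.ext h')
      omega
    simp only [this, if_true, Function.update_self, Function.update_of_ne h]
    rw [sub_sub, eta_one_sub, sub_add, eta_one_sub]
    ring

theorem nO_zero_ne (y : E r) (z m : Fin r) (hz : (z : ℕ) = 0) (hm : m ≠ z) :
    nO r (Function.update y z (1 - y z)) m = nO r y m := by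
  rw [nO_eq, nO_eq]
  refine Finset.sum_congr rfl fun j _ => ?_
  unfold fD
  by_cases h : j = z
  · subst h
    have : j < m := by
      rw [Fin.lt_def]
      have : (m : ℕ) ≠ j := fun h' => hm (Fin.ext h')
      omega
    simp only [this, this.not_gt, if_true, if_false, Function.update_self,
      Function.update_of_ne hm]
    rw [sub_sub, eta_one_sub, sub_add, eta_one_sub]
    ring
  · simp only [Function.update_of_ne h, Function.update_of_ne hm]

theorem nO_last_self (y : E r) (z : Fin r) (hz : (z : ℕ) + 1 = r) :
    nO r (Function.update y z (-y z)) z = -nO r y z := by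
  rw [nO_eq, nO_eq, ← Finset.sum_neg_distrib]
  refine Finset.sum_congr rfl fun j _ => ?_
  unfold fD
  by_cases h : j = z
  · simp [h]
  · have : j < z := by
      rw [Fin.lt_def]
      have : (j : ℕ) ≠ z := fun h' => h (Fin.ext h')
      omega
    simp only [this, this.not_gt, if_true, if_false, Function.update_self,
      Function.update_of_ne h]
    rw [sub_neg_eq_add, ← sub_eq_add_neg]
    ring

theorem nO_last_ne (y : E r) (z m : Fin r) (hz : (z : ℕ) + 1 = r) (hm : m ≠ z) :
    nO r (Function.update y z (-y z)) m = nO r y m := by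
  rw [nO_eq, nO_eq]
  refine Finset.sum_congr rfl fun j _ => ?_
  unfold fD
  by_cases h : j = z
  · subst h
    have : m < j := by
      rw [Fin.lt_def]
      have : (m : ℕ) ≠ j := fun h' => hm (Fin.ext h')
      omega
    simp only [this, if_true, Function.update_self,
      Function.update_of_ne hm]
    rw [sub_neg_eq_add, ← sub_eq_add_neg]
    ring
  · simp only [Function.update_of_ne h, Function.update_of_ne hm]

theorem swap_lt (p p' m j : Fin r) (h : (p' : ℕ) = (p : ℕ) + 1) (h1 : ¬ (m = p ∧ j = p'))
    (h2 : ¬ (m = p' ∧ j = p)) : Equiv.swap p p' m < Equiv.swap p p' j ↔ m < j := by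
  simp only [Equiv.swap_apply_def, Fin.ext_iff, Fin.lt_def] at *
  split_ifs <;> omega

theorem nO_mid (y : E r) (p p' m : Fin r) (h : (p' : ℕ) = (p : ℕ) + 1) (hne : y p ≠ y p') :
    nO r (y ∘ Equiv.swap p p') m = nO r y (Equiv.swap p p' m) := by
  rw [nO_eq, nO_eq, ← Equiv.sum_comp (Equiv.swap p p') (fun j => fD r y (Equiv.swap p p' m) j)]
  refine Finset.sum_congr rfl fun j _ => ?_
  have hlt : p < p' := by
    rw [Fin.lt_def]
    omega
  by_cases h1 : m = p ∧ j = p'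
  · obtain ⟨rfl, rfl⟩ := h1
    simp only [fD, Function.comp, Equiv.swap_apply_left, Equiv.swap_apply_right, hlt,
      hlt.not_gt, if_true, if_false]
    rw [← neg_sub, eta_neg _ (sub_ne_zero.2 hne), add_comm (y j)]
    ring
  · by_cases h2 : m = p' ∧ j = p
    · obtain ⟨rfl, rfl⟩ := h2
      simp only [fD, Function.comp, Equiv.swap_apply_left, Equiv.swap_apply_right, hlt,
        hlt.not_gt, if_true, if_false]
      rw [← neg_sub (y j) (y m), eta_neg _ (sub_ne_zero.2 hne), add_comm (y m)]
      ring
    · unfold fD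
      simp only [swap_lt r p p' m j h h1 h2, swap_lt r p p' j m h (by tauto) (by tauto),
        Function.comp]

/-- The basic step. -/
theorem sfrak_step (hr : 2 ≤ r) (k0 u0 k kr ur : Fˣ) (a : ℕ) (ha : a ≤ r) (y : E r)
    (hne : genF r a y ≠ y) :
    sfrak F r k0 u0 k kr ur (genF r a y)
      = torusAct0 F r (genF r a) (sfrak F r k0 u0 k kr ur y) := by
  rcases gen_cases r hr a ha with ⟨z, hz, rfl⟩ | ⟨z, hz, rfl⟩ | ⟨p, p', hp, rfl⟩
  · have hR : IsRep r (genF r 0) 1 (fun m => if m = z then -1 else 1)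
        (fun m => if m = z then 1 else 0) := by
      refine ⟨?_, ?_⟩
      · intro m
        by_cases h : m = z <;> simp [h]
      · intro y m
        rw [genF_zero r _ z hz]
        by_cases h : m = z
        · subst h
          simp
          ring
        · simp [h]
    funext m
    rw [torusAct0_rep F r _ _ _ _ hR]
    rw [genF_zero r _ z hz] at hne ⊢
    unfold sfrak
    by_cases h : m = z
    · subst h
      rw [nO_zero_self r y m hz]
      have h2 : 2 * y m ≠ 1 := by
        intro h'
        apply hne
        rw [show 1 - y m = y m by linarith]
        simp
      simp only [Function.update_self, Equiv.Perm.one_apply, if_true]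
      rw [show 2 * (1 - y m) = 2 - 2 * y m by ring, etaE_two_sub, etaO_two_sub _ h2]
      simp only [zpow_neg, zpow_one, mul_inv]
    · rw [nO_zero_ne r y z m hz h]
      simp [h]
  · have hR : IsRep a (genF a a) 1 (fun m => if m = z then -1 else 1) (fun m => 0) := by
      refine ⟨?_, ?_⟩
      · intro m
        by_cases h : m = z <;> simp [h]
      · intro y m
        rw [genF_last _ _ z hz]
        by_cases h : m = z
        · subst h
          simp
        · simp [h]
    funext m
    rw [torusAct0_rep F _ _ _ _ _ hR]
    rw [genF_last _ _ z hz] at hne ⊢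
    unfold sfrak
    by_cases h : m = z
    · subst h
      rw [nO_last_self _ y m hz]
      have h2 : 2 * y m ≠ 0 := by
        intro h'
        apply hne
        rw [show - y m = y m by linarith]
        simp
      simp only [Function.update_self, Equiv.Perm.one_apply, if_true]
      rw [show 2 * (- y m) = - (2 * y m) by ring, etaE_neg _ h2, etaO_neg]
      simp only [zpow_neg, zpow_one, mul_inv]
    · rw [nO_last_ne _ y z m hz h]
      simp [h]
  · have hR : IsRep r (genF r p') (Equiv.swap p p') (fun m => 1) (fun m => 0) := by
      refine ⟨?_, ?_⟩
      · intro m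
        simp
      · intro y m
        rw [genF_mid r _ p p' hp]
        simp
    funext m
    rw [torusAct0_rep F _ _ _ _ _ hR]
    rw [genF_mid r _ p p' hp] at hne ⊢
    have hy : y p ≠ y p' := by
      intro h'
      apply hne
      funext m
      simp only [Function.comp, Equiv.swap_apply_def]
      split_ifs with h1 h2
      · rw [h1, h']
      · rw [h2, h']
      · rfl
    unfold sfrak
    rw [nO_mid r y p p' m hp hy]
    simp

theorem wordAct_append (l l' : List ℕ) (y : E r) :
    wordAct r (l ++ l') y = wordAct r l (wordAct r l' y) := by
  simp [wordAct, List.foldr_append]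

theorem sfrak_word (hr : 2 ≤ r) (k0 u0 k kr ur : Fˣ) (l : List ℕ) (hl : ∀ a ∈ l, a ≤ r) :
    ∀ y : E r, wordAct r l.reverse y ∈ CplusCl r →
      (∀ l' : List ℕ, (∀ a ∈ l', a ≤ r) → wordAct r l'.reverse y ∈ CplusCl r →
        l.length ≤ l'.length) →
      sfrak F r k0 u0 k kr ur y
        = torusAct0 F r (wordAct r l) (sfrak F r k0 u0 k kr ur (wordAct r l.reverse y)) := by
  induction l with
  | nil =>
    intro y _ _
    funext m
    rw [torusAct0_rep F r (wordAct r []) 1 (fun _ => 1) (fun _ => 0)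
      ⟨by simp, by simp [wordAct]⟩]
    simp [wordAct]
  | cons a l ih =>
    intro y hy hmin
    have ha : a ≤ r := hl a List.mem_cons_self
    have hl' : ∀ b ∈ l, b ≤ r := fun b hb => hl b (List.mem_cons_of_mem _ hb)
    have key : ∀ (l : List ℕ) (y : E r),
        wordAct r (a :: l).reverse y = wordAct r l.reverse (genF r a y) := by
      intro l y
      rw [List.reverse_cons, wordAct_append]
      rfl
    rw [key] at hy ⊢
    rw [torusAct0_cons F r hr a l ha hl', ← ih hl' (genF r a y) hy]
    · have hne : genF r a y ≠ y := by
        intro h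
        rw [h] at hy
        have := hmin l hl' hy
        simp at this
      have := sfrak_step F r hr k0 u0 k kr ur a ha (genF r a y)
      rw [genF_invol r hr a ha] at this
      exact this hne.symm
    · intro l' hl'' h
      have := hmin (a :: l') (by
        intro b hb
        rcases List.mem_cons.1 hb with rfl | hb
        · exact ha
        · exact hl'' b hb) (by rw [key]; exact h)
      simpa using this

/-! fundamental domain -/

theorem fund_unique (hr : 2 ≤ r) (l : List ℕ) (hl : ∀ a ∈ l, a ≤ r) (y : E r)
    (hy : y ∈ CplusCl r) (hy' : wordAct r l y ∈ CplusCl r) : wordAct r l y = y := by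
  obtain ⟨σ, s, lam, h1, h2⟩ := isRep_word r hr l hl
  have e : wordAct r l y = y ∘ σ := by
    funext m
    have a1 := h2 y m
    have a2 := hy'.2 m
    have a3 := hy.2 (σ m)
    simp only [Function.comp]
    rw [a1] at a2 ⊢
    rcases h1 m with h | h
    · rw [h] at a2 ⊢
      push_cast at a2 ⊢
      have b1 : (lam m : ℝ) < 1 := by linarith
      have b2 : (-1 : ℝ) < lam m := by linarith
      have b3 : lam m < 1 := by exact_mod_cast b1
      have b4 : -1 < lam m := by exact_mod_cast b2
      have : lam m = 0 := by omega
      simp [this]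
    · rw [h] at a2 ⊢
      push_cast at a2 ⊢
      have b1 : (lam m : ℝ) < 2 := by linarith
      have b2 : (-1 : ℝ) < lam m := by linarith
      have b3 : lam m < 2 := by exact_mod_cast b1
      have b4 : -1 < lam m := by exact_mod_cast b2
      have : lam m = 0 ∨ lam m = 1 := by omega
      rcases this with h | h
      · rw [h] at a2 ⊢
        push_cast at a2 ⊢
        linarith
      · rw [h] at a2 ⊢
        push_cast at a2 ⊢
        linarith
  rw [e] at hy' ⊢
  have m1 : Monotone ((fun i => OrderDual.toDual (y i)) ∘ σ) := fun i j hij => hy'.1 i j hij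
  have m2 : Monotone ((fun i => OrderDual.toDual (y i)) ∘ (1 : Equiv.Perm (Fin r))) :=
    fun i j hij => hy.1 i j hij
  have := Tuple.unique_monotone m1 m2
  funext m
  exact congrFun this m

/-- reachability -/
def Rch (y z : E r) : Prop := ∃ l : List ℕ, (∀ a ∈ l, a ≤ r) ∧ wordAct r l y = z

theorem Rch.refl (y : E r) : Rch r y y := ⟨[], by simp, rfl⟩

theorem Rch.trans {x y z : E r} (h : Rch r x y) (h' : Rch r y z) : Rch r x z := by
  obtain ⟨l, hl, rfl⟩ := h
  obtain ⟨l', hl', rfl⟩ := h'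
  refine ⟨l' ++ l, ?_, wordAct_append r _ _ _⟩
  intro a ha
  rcases List.mem_append.1 ha with h | h
  · exact hl' a h
  · exact hl a h

theorem wordAct_reverse (hr : 2 ≤ r) (l : List ℕ) (hl : ∀ a ∈ l, a ≤ r) (y : E r) :
    wordAct r l.reverse (wordAct r l y) = y := by
  induction l with
  | nil => rfl
  | cons a l ih =>
    rw [List.reverse_cons, wordAct_append]
    change wordAct r l.reverse (genF r a (genF r a (wordAct r l y))) = y
    rw [genF_invol r hr a (hl a List.mem_cons_self)]
    exact ih fun b hb => hl b (List.mem_cons_of_mem _ hb)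

theorem Rch.symm (hr : 2 ≤ r) {x y : E r} (h : Rch r x y) : Rch r y x := by
  obtain ⟨l, hl, rfl⟩ := h
  exact ⟨l.reverse, fun a ha => hl a (List.mem_reverse.1 ha), wordAct_reverse r hr l hl x⟩

theorem Rch.gen (a : ℕ) (ha : a ≤ r) (y : E r) : Rch r y (genF r a y) :=
  ⟨[a], by simpa using ha, rfl⟩

theorem Rch.perm (σ : Equiv.Perm (Fin r)) : ∀ y : E r, Rch r y (y ∘ σ) := by
  cases r with
  | zero =>
    intro y
    rw [show y ∘ σ = y from Subsingleton.elim _ _]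
    exact Rch.refl _ y
  | succ n =>
    have : σ ∈ Submonoid.closure (Set.range fun i : Fin n ↦ Equiv.swap i.castSucc i.succ) := by
      rw [Equiv.Perm.mclosure_swap_castSucc_succ]
      trivial
    induction this using Submonoid.closure_induction with
    | mem x hx =>
      obtain ⟨i, rfl⟩ := hx
      intro y
      have := Rch.gen (n + 1) (i.succ : Fin (n + 1)) (by omega) y
      rwa [genF_mid (n + 1) y i.castSucc i.succ (by simp)] at this
    | one => exact fun y => Rch.refl _ y
    | mul a b _ _ ha hb =>
      intro y
      exact Rch.trans _ (ha y) (hb (y ∘ a))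

theorem Rch.conj (f : ℝ → ℝ) (z : Fin r) (h : ∀ y : E r, Rch r y (Function.update y z (f (y z))))
    (m : Fin r) (y : E r) : Rch r y (Function.update y m (f (y m))) := by
  have e : Function.update y m (f (y m)) =
      (Function.update (y ∘ Equiv.swap z m) z (f ((y ∘ Equiv.swap z m) z))) ∘ Equiv.swap z m := by
    funext i
    by_cases hi : i = m
    · subst hi
      simp
    · have : Equiv.swap z m i ≠ z := by
        intro h'
        apply hi
        have h3 := congrArg (Equiv.swap z m) h'
        simpa using h3
      simp [hi, this]
  rw [e]
  exact Rch.trans _ (Rch.perm _ _ y) (Rch.trans _ (h _) (Rch.perm _ _ _))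

theorem Rch.neg (hr : 2 ≤ r) (m : Fin r) (y : E r) : Rch r y (Function.update y m (-y m)) := by
  refine Rch.conj r (fun v => -v) ⟨r - 1, by omega⟩ (fun y => ?_) m y
  have := Rch.gen r r le_rfl y
  rwa [genF_last r y ⟨r - 1, by omega⟩ (by simp; omega)] at this

theorem Rch.one_sub (hr : 2 ≤ r) (m : Fin r) (y : E r) :
    Rch r y (Function.update y m (1 - y m)) := by
  refine Rch.conj r (fun v => 1 - v) ⟨0, by omega⟩ (fun y => ?_) m y
  have := Rch.gen r 0 (by omega) y
  rwa [genF_zero r y ⟨0, by omega⟩ rfl] at this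

theorem Rch.add_nat (hr : 2 ≤ r) (m : Fin r) (n : ℕ) :
    ∀ (y : E r), Rch r y (Function.update y m (y m + n)) := by
  induction n with
  | zero =>
    intro y
    simpa using Rch.refl r y
  | succ n ih =>
    intro y
    have := Rch.trans r (Rch.trans r (ih y) (Rch.neg r hr m _)) (Rch.one_sub r hr m _)
    simp only [Function.update_self, Function.update_idem] at this
    convert this using 2
    push_cast
    ring

theorem Rch.add_int (hr : 2 ≤ r) (m : Fin r) (n : ℤ) (y : E r) :
    Rch r y (Function.update y m (y m + n)) := by
  obtain ⟨k, rfl | rfl⟩ := n.eq_nat_or_neg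
  · exact_mod_cast Rch.add_nat r hr m k y
  · apply Rch.symm r hr
    have := Rch.add_nat r hr m k (Function.update y m (y m + ((-(k : ℤ) : ℤ) : ℝ)))
    simpa using this

theorem Rch.one_coord (hr : 2 ≤ r) (m : Fin r) (y : E r) :
    ∃ v : ℝ, 0 ≤ v ∧ v ≤ 1 / 2 ∧ Rch r y (Function.update y m v) := by
  have h1 := Rch.add_int r hr m (-round (y m)) y
  have h2 := abs_sub_round (y m)
  rw [abs_le] at h2
  have h3 : y m + ((-round (y m) : ℤ) : ℝ) = y m - round (y m) := by push_cast; ring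
  rw [h3] at h1
  by_cases h : 0 ≤ y m - round (y m)
  · exact ⟨_, h, h2.2, h1⟩
  · refine ⟨-(y m - round (y m)), by linarith, by linarith, ?_⟩
    have := Rch.trans r h1 (Rch.neg r hr m _)
    simpa only [Function.update_self, Function.update_idem] using this

theorem Rch.all_coord (hr : 2 ≤ r) (y : E r) (s : Finset (Fin r)) :
    ∃ z, Rch r y z ∧ ∀ m ∈ s, 0 ≤ z m ∧ z m ≤ 1 / 2 := by
  induction s using Finset.induction_on with
  | empty => exact ⟨y, Rch.refl r y, by simp⟩
  | insert a s ha ih =>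
    obtain ⟨z, hz, hs⟩ := ih
    obtain ⟨v, hv0, hv1, hv⟩ := Rch.one_coord r hr a z
    refine ⟨_, Rch.trans r hz hv, ?_⟩
    intro m hm
    by_cases h : m = a
    · subst h
      simp only [Function.update_self]
      exact ⟨hv0, hv1⟩
    · rw [Function.update_of_ne h]
      exact hs m (Finset.mem_of_mem_insert_of_ne hm h)

theorem Rch.alcove (hr : 2 ≤ r) (y : E r) : ∃ z, Rch r y z ∧ z ∈ CplusCl r := by
  obtain ⟨z, hz, h⟩ := Rch.all_coord r hr y Finset.univ
  refine ⟨_, Rch.trans r hz (Rch.perm r (Tuple.sort fun i => OrderDual.toDual (z i)) z), ?_, ?_⟩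
  · intro i j hij
    exact Tuple.monotone_sort (fun i => OrderDual.toDual (z i)) hij
  · intro m
    exact h _ (Finset.mem_univ _)

theorem gW_spec (hr : 2 ≤ r) (y : E r) :
    (∀ a ∈ gW r y, a ≤ r) ∧ wordAct r (gW r y).reverse y ∈ CplusCl r ∧
      ∀ l' : List ℕ, (∀ a ∈ l', a ≤ r) → wordAct r l'.reverse y ∈ CplusCl r →
        (gW r y).length ≤ l'.length := by
  have h : ∃ l : List ℕ, (∀ a ∈ l, a ≤ r) ∧ wordAct r l.reverse y ∈ CplusCl r ∧
      ∀ l' : List ℕ, (∀ a ∈ l', a ≤ r) → wordAct r l'.reverse y ∈ CplusCl r →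
        l.length ≤ l'.length := by
    obtain ⟨z, ⟨l, hl, rfl⟩, hz⟩ := Rch.alcove r hr y
    have hex : ∃ n : ℕ, ∃ l : List ℕ, l.length = n ∧ (∀ a ∈ l, a ≤ r) ∧
        wordAct r l.reverse y ∈ CplusCl r :=
      ⟨_, l.reverse, rfl, fun a ha => hl a (List.mem_reverse.1 ha), by
        rwa [List.reverse_reverse]⟩
    obtain ⟨l0, h0, h1, h2⟩ := Nat.find_spec hex
    refine ⟨l0, h1, h2, fun l' hl' h' => ?_⟩
    rw [h0]
    exact Nat.find_min' hex ⟨l', rfl, hl', h'⟩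
  unfold gW
  rw [dif_pos h]
  exact h.choose_spec

theorem cpt_spec (hr : 2 ≤ r) (O : Set (E r)) (hO : IsOrbit r O) :
    cpt r O ∈ O ∧ cpt r O ∈ CplusCl r := by
  have h : ∃ c, c ∈ O ∧ c ∈ CplusCl r := by
    obtain ⟨y, rfl⟩ := hO
    obtain ⟨z, hz, hz'⟩ := Rch.alcove r hr y
    exact ⟨z, hz, hz'⟩
  unfold cpt
  rw [dif_pos h]
  exact h.choose_spec

theorem gW_cpt (hr : 2 ≤ r) (O : Set (E r)) (hO : IsOrbit r O) (y : E r) (hy : y ∈ O) :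
    wordAct r (gW r y).reverse y = cpt r O := by
  obtain ⟨hc, hc'⟩ := cpt_spec r hr O hO
  obtain ⟨g1, g2, -⟩ := gW_spec r hr y
  obtain ⟨y0, rfl⟩ := hO
  have h1 : Rch r y (wordAct r (gW r y).reverse y) :=
    ⟨_, fun a ha => g1 a (List.mem_reverse.1 ha), rfl⟩
  have h2 : Rch r (cpt r (orbit r y0)) (wordAct r (gW r y).reverse y) :=
    Rch.trans r (Rch.symm r hr hc) (Rch.trans r hy h1)
  obtain ⟨l, hl, h⟩ := h2
  rw [← h]
  exact fund_unique r hr l hl _ hc' (by rw [h]; exact g2)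

/-! parts 3 and 4 -/

theorem sfrak_alcove (k0 u0 k kr ur : Fˣ) (O : Set (E r)) (hc : cpt r O ∈ CplusCl r) :
    sfrak F r k0 u0 k kr ur (cpt r O) = sOtor F r k0 u0 k kr ur O := by
  funext m
  have h := hc.2 m
  unfold sfrak sOtor
  have e1 : etaE (2 * cpt r O m) = -(chiE (2 * cpt r O m) : ℤ) := by
    unfold etaE chiE
    have h2 : ¬ (2 : ℝ) ≤ 2 * cpt r O m := by linarith
    simp only [if_neg h2]
    split_ifs <;> simp
  have e2 : etaO (2 * cpt r O m) = (chiO (2 * cpt r O m) : ℤ) := by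
    unfold etaO chiO
    split_ifs with h1 h2
    · simp
    · obtain ⟨n, hn⟩ := h1
      exfalso
      have b1 : (-1 : ℝ) < n := by linarith
      have b2 : (n : ℝ) < 0 := by linarith
      have b3 : -1 < n := by exact_mod_cast b1
      have b4 : n < 0 := by exact_mod_cast b2
      omega
    · simp
  rw [e1, e2]

theorem upow_single (t : Fin r → Fˣ) (lam : Fin r → ℤ) (z : Fin r)
    (h : ∀ m, m ≠ z → lam m = 0) : upow F r t lam = t z ^ lam z := by
  unfold upow
  rw [Finset.prod_eq_single z]
  · intro b _ hb
    rw [h b hb, zpow_zero]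
  · simp

theorem upow_pair (t : Fin r → Fˣ) (lam : Fin r → ℤ) (p p' : Fin r) (hne : p ≠ p')
    (h : ∀ m, m ≠ p → m ≠ p' → lam m = 0) :
    upow F r t lam = t p ^ lam p * t p' ^ lam p' := by
  unfold upow
  rw [← Finset.prod_pair hne (f := fun m => t m ^ lam m)]
  symm
  apply Finset.prod_subset (Finset.subset_univ _)
  intro m _ hm
  simp only [Finset.mem_insert, Finset.mem_singleton, not_or] at hm
  rw [h m hm.1 hm.2, zpow_zero]

theorem nO_diff (y : E r) (p p' : Fin r) (h : (p' : ℕ) = (p : ℕ) + 1) (he : y p = y p') :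
    nO r y p = nO r y p' - 2 := by
  have hlt : p < p' := by
    rw [Fin.lt_def]
    omega
  rw [nO_eq, nO_eq, ← Equiv.sum_comp (Equiv.swap p p') (fun j => fD r y p j)]
  have : ∀ j, fD r y p (Equiv.swap p p' j) = fD r y p' j + if j = p then -2 else 0 := by
    intro j
    by_cases h1 : j = p
    · subst h1
      simp only [fD, Equiv.swap_apply_left, hlt, hlt.not_gt, if_true, if_false, he, sub_self,
        eta_zero]
      ring
    · by_cases h2 : j = p'
      · subst h2
        simp [fD, hlt.ne']
      · rw [Equiv.swap_apply_of_ne_of_ne h1 h2]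
        have n1 : (j : ℕ) ≠ p := fun h' => h1 (Fin.ext h')
        have n2 : (j : ℕ) ≠ p' := fun h' => h2 (Fin.ext h')
        have e1 : p < j ↔ p' < j := by
          rw [Fin.lt_def, Fin.lt_def]
          omega
        have e2 : j < p ↔ j < p' := by
          rw [Fin.lt_def, Fin.lt_def]
          omega
        simp [fD, e1, e2, he, h1]
  rw [Finset.sum_congr rfl fun j _ => this j, Finset.sum_add_distrib]
  simp
  ring

theorem part4 (hr : 2 ≤ r) (k0 u0 k kr ur : Fˣ) (c : E r) (j : ℕ) (hj : j ≤ r)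
    (h : alphaF r j c = 0) :
    upow F r (sfrak F r k0 u0 k kr ur c) (abarV r j) = (cpar F r k0 u0 k kr ur j)⁻¹ := by
  rcases gen_cases r hr j hj with ⟨z, hz, rfl⟩ | ⟨z, hz, rfl⟩ | ⟨p, p', hp, rfl⟩
  · have hc : c z = 1 / 2 := by
      simp only [alphaF, if_true] at h
      rw [cd_eq r c z 1 (by omega)] at h
      linarith
    rw [upow_single F r _ _ z]
    · have n0 : nO r c z = 0 := by
        rw [nO_eq]
        refine Finset.sum_eq_zero fun j _ => ?_
        unfold fD
        have : ¬ j < z := by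
          rw [Fin.lt_def]
          omega
        rw [if_neg this]
        split_ifs
        · rw [hc, show (1 / 2 : ℝ) - c j = 1 - (1 / 2 + c j) by ring, eta_one_sub]
          ring
        · rfl
      have h1 : etaE (2 * c z) = 0 := by
        rw [hc]
        apply etaE_not
        rintro ⟨n, hn⟩
        have : (1 : ℝ) = ((2 * n : ℤ) : ℝ) := by
          push_cast
          linarith
        have : 1 = 2 * n := by exact_mod_cast this
        omega
      have h2 : etaO (2 * c z) = 1 := by
        rw [hc]
        have := etaO_odd 0
        simpa using this
      simp [sfrak, n0, h1, h2, cpar, abarV, hz]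
    · intro m hm
      have : (m : ℕ) ≠ 0 := fun h' => hm (Fin.ext (by omega))
      simp [abarV, this]
  · have j0 : j ≠ 0 := by omega
    have hc : c z = 0 := by
      simp only [alphaF, if_true, if_neg j0] at h
      rw [cd_eq _ c z _ hz] at h
      linarith
    rw [upow_single F _ _ _ z]
    · have n0 : nO _ c z = 0 := by
        rw [nO_eq]
        refine Finset.sum_eq_zero fun i _ => ?_
        unfold fD
        have : ¬ z < i := by
          rw [Fin.lt_def]
          omega
        rw [if_neg this]
        split_ifs
        · simp [hc]
        · rfl
      have h1 : etaE (2 * c z) = -1 := by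
        rw [hc]
        have := etaE_even 0
        simpa using this
      have h2 : etaO (2 * c z) = 0 := by
        rw [hc]
        apply etaO_not
        rintro ⟨n, hn⟩
        have : (0 : ℝ) = ((2 * n + 1 : ℤ) : ℝ) := by
          push_cast
          linarith
        have : 0 = 2 * n + 1 := by exact_mod_cast this
        omega
      simp [sfrak, n0, h1, h2, cpar, abarV, hz, j0]
    · intro m hm
      have : (m : ℕ) + 1 ≠ j := fun h' => hm (Fin.ext (by omega))
      simp [abarV, this, j0]
  · have h0 : (p' : ℕ) ≠ 0 := by omega
    have h1 : (p' : ℕ) ≠ r := by omega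
    have hne : p ≠ p' := by
      rintro rfl
      omega
    have hc : c p = c p' := by
      simp only [alphaF, if_neg h0, if_neg h1] at h
      rw [cd_eq _ c p _ hp.symm, cd_eq _ c p' _ rfl] at h
      linarith
    rw [upow_pair F r _ _ p p' hne]
    · have a1 : abarV r p' p = 1 := by simp [abarV, h0, h1, hp]
      have a2 : abarV r p' p' = -1 := by simp [abarV, h0, h1]
      rw [a1, a2]
      simp only [sfrak, cpar, if_neg h0, if_neg h1]
      rw [nO_diff r c p p' hp hc, hc, zpow_sub, zpow_one, zpow_neg, zpow_one, mul_inv, mul_inv k k]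
      have key : ∀ A K : Fˣ, A * (K * (k ^ (2 : ℤ))⁻¹) * (A⁻¹ * K⁻¹) = k⁻¹ * k⁻¹ := by
        intro A K
        rw [show A * (K * (k ^ (2 : ℤ))⁻¹) * (A⁻¹ * K⁻¹) =
          (A * A⁻¹) * (K * K⁻¹) * (k ^ (2 : ℤ))⁻¹ by ac_rfl, mul_inv_cancel, mul_inv_cancel]
        group
      exact key _ _
    · intro m hm hm'
      have e1 : (m : ℕ) + 1 ≠ p' := fun h' => hm (Fin.ext (by omega))
      have e2 : (m : ℕ) ≠ p' := fun h' => hm' (Fin.ext h')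
      simp [abarV, h0, h1, e1, e2]

/-- For `y` in the `W`-orbit `𝒪`: `𝔰_y = ḡ_y(𝔰_{c^𝒪})`,
`𝔰_y·(g_y t) = g_y(𝔰_{c^𝒪}·t)` for `t ∈ T_𝒪`, `𝔰_{c^𝒪} = 𝔰^𝒪`, and
`𝔰_{c^𝒪}^{ᾱ_j^∨} = c_j⁻¹` for all `j ∈ J(𝒪)`. -/
theorem statement15 (F : Type*) [Field F] [CharZero F] (r : ℕ) (hr : 2 ≤ r)
    (qh k0 u0 k kr ur : Fˣ) (O : Set (E r)) (hO : IsOrbit r O) (y : E r) (hy : y ∈ O) :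
    (sfrak F r k0 u0 k kr ur y
      = torusAct0 F r (gfun r y) (sfrak F r k0 u0 k kr ur (cpt r O))) ∧
    (∀ t ∈ TOset F r qh O,
      (fun m => sfrak F r k0 u0 k kr ur y m * torusAct F r qh (gfun r y) t m)
        = torusAct F r qh (gfun r y)
            (fun m => sfrak F r k0 u0 k kr ur (cpt r O) m * t m)) ∧
    (sfrak F r k0 u0 k kr ur (cpt r O) = sOtor F r k0 u0 k kr ur O) ∧
    (∀ j : ℕ, j ≤ r → alphaF r j (cpt r O) = 0 →
      upow F r (sfrak F r k0 u0 k kr ur (cpt r O)) (abarV r j)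
        = (cpar F r k0 u0 k kr ur j)⁻¹) := by
  obtain ⟨hc, hc'⟩ := cpt_spec r hr O hO
  obtain ⟨g1, g2, g3⟩ := gW_spec r hr y
  have p1 : sfrak F r k0 u0 k kr ur y
      = torusAct0 F r (gfun r y) (sfrak F r k0 u0 k kr ur (cpt r O)) := by
    rw [← gW_cpt r hr O hO y hy]
    exact sfrak_word F r hr k0 u0 k kr ur (gW r y) g1 y g2 g3
  refine ⟨p1, ?_, sfrak_alcove F r k0 u0 k kr ur O hc', ?_⟩
  · intro t _
    rw [p1]
    funext m
    simp only [torusAct0, torusAct, mul_zpow, Finset.prod_mul_distrib]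
    exact mul_left_comm _ _ _
  · intro j hj h
    exact part4 F r hr k0 u0 k kr ur _ j hj h

end QP

end
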